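/- For all n ≥ 1 and k ≥ 1, the following identity holds in ℚ[x_1,…,x_k,t]: W_n^<(x,t) = Σ_{λ ⊢ n} (−1)^{n−ℓ(λ)} c_λ^<(t) p_λ(x)/z_λ, where W_n^<(x,t) := Σ_w t^{des(w)} x_w (sum over Smirnov words w of length n over [k] with w_1 < w_n), c_λ^<(t) := (d/dt)( t · A_{ℓ(λ)−1}(t) · ∏_{i=1}^{ℓ(λ)} [λ_i]_t ) for ℓ(λ) ≥ 2, and c_{(n)}^<(t) := (d/dt) [n]_t. (This is the statement ω W_n^<(x,t) = Σ_{λ⊢n} c_λ^<(t) p_λ(x)/z_λ for the standard involution ω on symmetric functions, rewritten without ω using ω p_λ = (−1)^{n−ℓ(λ)} p_λ.) -/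

import Mathlib

open Finset MvPolynomial Polynomial

attribute [local instance] Classical.propDecidable

noncomputable section

/-- The descent number of a word `w = w₁⋯wₙ` over the alphabet `[k]`:
the number of indices `i ∈ [n-1]` with `wᵢ > wᵢ₊₁`. -/
def desc {n k : ℕ} (w : Fin n → Fin k) : ℕ :=
  (Finset.univ.filter fun i : Fin n =>
    ∃ h : (i : ℕ) + 1 < n, w ⟨(i : ℕ) + 1, h⟩ < w i).card

/-- The cyclic descent number: the number of indices `i ∈ [n]` with `wᵢ > wᵢ₊₁`,
where `wₙ₊₁ := w₁`. -/
def cdesc {n k : ℕ} (w : Fin n → Fin k) : ℕ :=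
  (Finset.univ.filter fun i : Fin n =>
    w ⟨((i : ℕ) + 1) % n, Nat.mod_lt _ i.pos⟩ < w i).card

/-- A word is Smirnov if no two adjacent letters are equal. -/
def IsSmirnov {n k : ℕ} (w : Fin n → Fin k) : Prop :=
  ∀ i : Fin n, ∀ h : (i : ℕ) + 1 < n, w ⟨(i : ℕ) + 1, h⟩ ≠ w i

/-- the first letter is strictly smaller than the last letter -/
def FirstLtLast {n k : ℕ} (w : Fin n → Fin k) : Prop :=
  ∃ h : 0 < n, w ⟨0, h⟩ < w ⟨n - 1, Nat.sub_lt h Nat.one_pos⟩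

/-- the first letter is strictly larger than the last letter -/
def FirstGtLast {n k : ℕ} (w : Fin n → Fin k) : Prop :=
  ∃ h : 0 < n, w ⟨n - 1, Nat.sub_lt h Nat.one_pos⟩ < w ⟨0, h⟩

/-- the first letter equals the last letter -/
def FirstEqLast {n k : ℕ} (w : Fin n → Fin k) : Prop :=
  ∃ h : 0 < n, w ⟨0, h⟩ = w ⟨n - 1, Nat.sub_lt h Nat.one_pos⟩

/-- the first letter differs from the last letter -/
def FirstNeLast {n k : ℕ} (w : Fin n → Fin k) : Prop :=
  ∃ h : 0 < n, w ⟨0, h⟩ ≠ w ⟨n - 1, Nat.sub_lt h Nat.one_pos⟩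

/-- the monomial `x_w = x_{w₁}⋯x_{wₙ}` -/
def xw (R : Type) [CommRing R] {n k : ℕ} (w : Fin n → Fin k) : MvPolynomial (Fin k) R :=
  ∏ i, MvPolynomial.X (w i)

/-- Generic restricted Smirnov word enumerator: the sum of `t^(stat w) · x_w` over all
Smirnov words `w` of length `n` over `[k]` satisfying `P`, as a polynomial in `t`
with coefficients in `R[x₁,…,x_k]`. -/
def smirnovEnum (R : Type) [CommRing R] (n k : ℕ) (stat : (Fin n → Fin k) → ℕ)
    (P : (Fin n → Fin k) → Prop) : Polynomial (MvPolynomial (Fin k) R) :=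
  ∑ w ∈ Finset.univ.filter (fun w : Fin n → Fin k => IsSmirnov w ∧ P w),
    Polynomial.X ^ stat w * Polynomial.C (xw R w)

/-- the t-analogue `[m]_t = 1 + t + ⋯ + t^(m-1)`, as a polynomial in `t = Polynomial.X`
with coefficients in `R[x₁,…,x_k]` -/
def tnum (R : Type) [CommRing R] (k m : ℕ) : Polynomial (MvPolynomial (Fin k) R) :=
  ∑ j ∈ Finset.range m, Polynomial.X ^ j

/-- `D(x,t,z) = 1 - Σ_{i≥2} t[i-1]_t e_i(x) z^i`, a formal power series in `z` whose
coefficients are polynomials in `t` with coefficients in `R[x₁,…,x_k]`. -/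
def Dser (R : Type) [CommRing R] (k : ℕ) : PowerSeries (Polynomial (MvPolynomial (Fin k) R)) :=
  PowerSeries.mk fun i =>
    if i = 0 then 1
    else if i = 1 then 0
    else -(Polynomial.X * tnum R k (i - 1) * Polynomial.C (esymm (Fin k) R i))

/-- `Des_{≥2}(σ) = {i ∈ [n-1] : σ(i) - σ(i+1) ≥ 2}`, recorded via 0-based gap positions:
gap `g ∈ {0,…,n-2}` corresponds to the adjacent pair `(σ g, σ (g+1))`. -/
def Des2 {n : ℕ} (σ : Equiv.Perm (Fin n)) : Finset ℕ :=
  (Finset.range n).filter fun g =>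
    ∃ h : g + 1 < n, (σ ⟨g + 1, h⟩ : ℕ) + 2 ≤ (σ ⟨g, Nat.lt_of_succ_lt h⟩ : ℕ)

/-- `Asc_{≥2}(σ) = {i ∈ [n-1] : σ(i+1) - σ(i) ≥ 2}`, recorded via 0-based gap positions. -/
def Asc2 {n : ℕ} (σ : Equiv.Perm (Fin n)) : Finset ℕ :=
  (Finset.range n).filter fun g =>
    ∃ h : g + 1 < n, (σ ⟨g, Nat.lt_of_succ_lt h⟩ : ℕ) + 2 ≤ (σ ⟨g + 1, h⟩ : ℕ)

/-- `maj_{≥2}(σ) = Σ i` over the (1-based) positions `i ∈ [n-1]` with `σ(i+1) - σ(i) ≥ 2`;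
a 0-based gap `g` corresponds to the 1-based position `g + 1`. -/
def maj2 {n : ℕ} (σ : Equiv.Perm (Fin n)) : ℕ :=
  ∑ g ∈ Asc2 σ, (g + 1)

/-- The Eulerian polynomial `A_m(t) = Σ_{σ ∈ S_m} t^{des σ}`. -/
def Eul (R : Type) [CommRing R] (m : ℕ) : Polynomial R :=
  ∑ σ : Equiv.Perm (Fin m), Polynomial.X ^ desc ⇑σ

/-- `z_λ = ∏_i i^{m_i} m_i!` where `m_i` is the number of parts of `λ` equal to `i` -/
def zlam {n : ℕ} (μ : n.Partition) : ℕ :=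
  ∏ i ∈ μ.parts.toFinset, i ^ μ.parts.count i * (μ.parts.count i).factorial

/-- the coefficient `c_λ^<(t)` of `p_λ/z_λ` in `ω W_n^<`:
`c_{(n)}^<(t) = (d/dt)[n]_t` and, for `ℓ(λ) ≥ 2`,
`c_λ^<(t) = (d/dt)( t A_{ℓ(λ)-1}(t) ∏_i [λ_i]_t )`. -/
def cless (k n : ℕ) (μ : n.Partition) : Polynomial (MvPolynomial (Fin k) ℚ) :=
  if μ.parts.card = 1 then Polynomial.derivative (tnum ℚ k n)
  else
    Polynomial.derivative
      (Polynomial.X * Eul (MvPolynomial (Fin k) ℚ) (μ.parts.card - 1) *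
        (μ.parts.map (tnum ℚ k)).prod)

/-! Euler operator `z d/dz` and coefficientwise operators -/

def theta {P : Type} [CommRing P] (f : PowerSeries P) : PowerSeries P :=
  PowerSeries.mk fun n => (n : P) * PowerSeries.coeff n f

theorem theta_mul {P : Type} [CommRing P] (f g : PowerSeries P) :
    theta (f * g) = theta f * g + f * theta g := by
  ext n
  simp only [theta, PowerSeries.coeff_mk, PowerSeries.coeff_mul, map_add, Finset.mul_sum,
    ← Finset.sum_add_distrib]
  refine Finset.sum_congr rfl fun p hp => ?_
  rw [← Finset.HasAntidiagonal.mem_antidiagonal.1 hp]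
  push_cast
  ring

theorem theta_add {P : Type} [CommRing P] (f g : PowerSeries P) :
    theta (f + g) = theta f + theta g := by
  ext n; simp [theta, mul_add]

theorem theta_sub {P : Type} [CommRing P] (f g : PowerSeries P) :
    theta (f - g) = theta f - theta g := by
  ext n; simp [theta, mul_sub]

theorem theta_C {P : Type} [CommRing P] (c : P) :
    theta (PowerSeries.C c) = 0 := by
  ext n
  rcases n with _ | n <;> simp [theta, PowerSeries.coeff_C]

theorem theta_ode {P : Type} [CommRing P] [IsDomain P] [CharZero P]
    (f M : PowerSeries P) (hM : PowerSeries.coeff 0 M = 0) (h0 : PowerSeries.coeff 0 f = 0)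
    (h : theta f = M * f) : f = 0 := by
  ext n
  induction n using Nat.strong_induction_on with
  | _ n ih =>
    rcases Nat.eq_zero_or_pos n with rfl | hn
    · simpa using h0
    · have h1 := congrArg (PowerSeries.coeff n) h
      simp only [theta, PowerSeries.coeff_mk, PowerSeries.coeff_mul] at h1
      have h2 : ∑ p ∈ Finset.HasAntidiagonal.antidiagonal n, PowerSeries.coeff p.1 M * PowerSeries.coeff p.2 f = 0 := by
        refine Finset.sum_eq_zero fun p hp => ?_
        rcases Nat.eq_zero_or_pos p.1 with h | h
        · rw [h, hM, zero_mul]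
        · rw [ih p.2 (by have := Finset.HasAntidiagonal.mem_antidiagonal.1 hp; omega)]; simp
      rw [h2] at h1
      have : (n : P) ≠ 0 := by exact_mod_cast hn.ne'
      simpa using (mul_eq_zero.1 h1).resolve_left this

def dt {A : Type} [CommRing A] (f : PowerSeries (Polynomial A)) : PowerSeries (Polynomial A) :=
  PowerSeries.mk fun n => Polynomial.derivative (PowerSeries.coeff n f)

theorem dt_mul {A : Type} [CommRing A] (f g : PowerSeries (Polynomial A)) :
    dt (f * g) = dt f * g + f * dt g := by
  ext1 n
  simp only [dt, PowerSeries.coeff_mk, PowerSeries.coeff_mul, map_add, 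
    ← Finset.sum_add_distrib, Polynomial.derivative_sum, Polynomial.derivative_mul]

theorem dt_add {A : Type} [CommRing A] (f g : PowerSeries (Polynomial A)) :
    dt (f + g) = dt f + dt g := by
  ext1 n; simp [dt]

theorem dt_sub {A : Type} [CommRing A] (f g : PowerSeries (Polynomial A)) :
    dt (f - g) = dt f - dt g := by
  ext1 n; simp [dt]

theorem dt_theta {A : Type} [CommRing A] (f : PowerSeries (Polynomial A)) :
    dt (theta f) = theta (dt f) := by
  ext1 n; simp [dt, theta]

/-! Partitions -/

def zl (s : Multiset ℕ) : ℕ :=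
  ∏ i ∈ s.toFinset, i ^ s.count i * (s.count i).factorial

theorem zl_cons (i : ℕ) (s : Multiset ℕ) :
    zl (i ::ₘ s) = i * (i ::ₘ s).count i * zl s := by
  have h1 : zl s = ∏ j ∈ insert i s.toFinset, j ^ s.count j * (s.count j).factorial := by
    unfold zl
    refine Finset.prod_subset (Finset.subset_insert _ _) fun j _ hj => ?_
    rw [Multiset.mem_toFinset] at hj
    simp [Multiset.count_eq_zero_of_notMem hj]
  rw [h1, zl, Multiset.toFinset_cons, ← Finset.mul_prod_erase _ _ (Finset.mem_insert_self i _),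
    ← Finset.mul_prod_erase _ _ (Finset.mem_insert_self i _), ← mul_assoc]
  congr 1
  · rw [Multiset.count_cons_self, Nat.factorial_succ]; ring
  · refine Finset.prod_congr rfl fun j hj => ?_
    rw [Multiset.count_cons_of_ne (Finset.ne_of_mem_erase hj)]

theorem zl_ne_zero (s : Multiset ℕ) (hs : ∀ i ∈ s, 0 < i) : zl s ≠ 0 := by
  unfold zl
  refine Finset.prod_ne_zero_iff.2 fun i hi => ?_
  have := hs i (Multiset.mem_toFinset.1 hi)
  positivity

def wtm {P : Type} [CommRing P] [Algebra ℚ P] (q : ℕ → P) (s : Multiset ℕ) : P :=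
  (1 / (zl s : ℚ)) • (s.map q).prod

def Phi {P : Type} [CommRing P] [Algebra ℚ P] (q : ℕ → P) (b : ℕ → P) : PowerSeries P :=
  PowerSeries.mk fun n => ∑ ν : n.Partition, b ν.parts.card * wtm q ν.parts

theorem sum_partition_mem {P : Type} [CommRing P] (F : Multiset ℕ → P) (i j : ℕ) (hi : 0 < i) :
    ∑ ν : (i + j).Partition, (if i ∈ ν.parts then F ν.parts else 0) =
      ∑ ν : j.Partition, F (i ::ₘ ν.parts) := by
  rw [← Finset.sum_filter]
  symm
  refine Finset.sum_bij (fun ν _ => (⟨i ::ₘ ν.parts, ?_, ?_⟩ : (i+j).Partition)) ?_ ?_ ?_ ?_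
  · intro a ha
    rcases Multiset.mem_cons.1 ha with rfl | h
    · exact hi
    · exact ν.parts_pos h
  · simp [ν.parts_sum]
  · intro ν _; simp
  · intro a _ b _ h
    have h2 := congrArg Nat.Partition.parts h
    simp only [Multiset.cons_inj_right] at h2
    exact Nat.Partition.ext h2
  · intro ν hν
    have hm := (Finset.mem_filter.1 hν).2
    obtain ⟨s, hs⟩ := Multiset.exists_cons_of_mem hm
    refine ⟨⟨s, ?_, ?_⟩, Finset.mem_univ _, ?_⟩
    · intro a ha
      exact ν.parts_pos (by rw [hs]; exact Multiset.mem_cons_of_mem ha)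
    · have := ν.parts_sum
      rw [hs, Multiset.sum_cons] at this; omega
    · apply Nat.Partition.ext; simp [hs]
  · intro ν _; rfl

theorem wtm_cons {P : Type} [CommRing P] [Algebra ℚ P] (q : ℕ → P) (i : ℕ) (hi : 0 < i)
    (s : Multiset ℕ) :
    ((i * (i ::ₘ s).count i : ℕ) : P) * wtm q (i ::ₘ s) = q i * wtm q s := by
  unfold wtm
  rw [zl_cons, Multiset.map_cons, Multiset.prod_cons]
  have hc : ((i * (i ::ₘ s).count i : ℕ) : ℚ) ≠ 0 := by
    rw [Multiset.count_cons_self]; positivity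
  have : ((i * (i ::ₘ s).count i : ℕ) : P) = algebraMap ℚ P ((i * (i ::ₘ s).count i : ℕ) : ℚ) := by
    simp
  rw [this, ← Algebra.smul_def, smul_smul, mul_smul_comm]
  congr 1
  push_cast at hc ⊢
  rw [one_div, mul_inv, ← mul_assoc, mul_inv_cancel₀ hc, one_mul, one_div]

theorem theta_Phi {P : Type} [CommRing P] [Algebra ℚ P] (q : ℕ → P) (hq : q 0 = 0) (b : ℕ → P) :
    theta (Phi q b) = PowerSeries.mk q * Phi q (fun m => b (m + 1)) := by
  ext n
  simp only [theta, Phi, PowerSeries.coeff_mk, PowerSeries.coeff_mul]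
  have key : ∀ ν : n.Partition, (n : P) = ∑ p ∈ Finset.HasAntidiagonal.antidiagonal n,
      if p.1 ∈ ν.parts then ((p.1 * ν.parts.count p.1 : ℕ) : P) else 0 := by
    intro ν
    rw [Finset.Nat.sum_antidiagonal_eq_sum_range_succ_mk]
    have h1 : n = ∑ i ∈ ν.parts.toFinset, i * ν.parts.count i := by
      conv_lhs => rw [← ν.parts_sum]
      rw [Finset.sum_multiset_count]
      refine Finset.sum_congr rfl fun i _ => ?_
      rw [smul_eq_mul, mul_comm]
    conv_lhs => rw [h1]
    push_cast
    rw [← Finset.sum_filter]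
    refine Finset.sum_congr ?_ fun _ _ => rfl
    ext i
    simp only [Multiset.mem_toFinset, Finset.mem_filter, Finset.mem_range]
    refine ⟨fun h => ⟨?_, h⟩, fun h => h.2⟩
    have := Multiset.le_sum_of_mem h
    rw [ν.parts_sum] at this
    omega
  rw [Finset.mul_sum]
  rw [Finset.sum_congr rfl fun ν _ => by rw [key ν, Finset.sum_mul], Finset.sum_comm]
  refine Finset.sum_congr rfl fun p hp => ?_
  obtain ⟨i, j⟩ := p
  have hp := Finset.HasAntidiagonal.mem_antidiagonal.1 hp
  simp only at hp ⊢
  subst hp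
  rcases Nat.eq_zero_or_pos i with rfl | hi
  · rw [hq, zero_mul]
    refine Finset.sum_eq_zero fun ν _ => ?_
    simp
  · rw [Finset.mul_sum]
    have := sum_partition_mem (P := P)
      (fun s => ((i * s.count i : ℕ) : P) * (b s.card * wtm q s)) i j hi
    simp only [ite_mul, zero_mul]
    rw [this]
    refine Finset.sum_congr rfl fun ν _ => ?_
    have := wtm_cons q i hi ν.parts
    rw [mul_left_comm, this, Multiset.card_cons]; ring

theorem coeff_zero_Phi {P : Type} [CommRing P] [Algebra ℚ P] (q : ℕ → P) (b : ℕ → P) :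
    PowerSeries.coeff 0 (Phi q b) = b 0 := by
  simp only [Phi, PowerSeries.coeff_mk]
  rw [Fintype.sum_unique]
  simp [wtm, zl]

theorem Phi_mul {P : Type} [CommRing P] [IsDomain P] [CharZero P] [Algebra ℚ P]
    (q : ℕ → P) (hq : q 0 = 0) (c : P) (b : ℕ → P) :
    Phi q (fun m => c ^ m) * Phi q b =
      Phi q (fun m => ∑ p ∈ Finset.HasAntidiagonal.antidiagonal m, (m.choose p.1 : P) * c ^ p.1 * b p.2) := by
  have hM : PowerSeries.coeff 0 (PowerSeries.mk q) = 0 := by simp [hq]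
  have hE : Phi q (fun m => c ^ (m + 1)) = PowerSeries.C c * Phi q (fun m => c ^ m) := by
    ext n
    simp only [Phi, PowerSeries.coeff_mk, PowerSeries.coeff_C_mul, Finset.mul_sum]
    refine Finset.sum_congr rfl fun ν _ => ?_
    ring
  have hadd : ∀ b b' : ℕ → P, Phi q (fun m => b m + c * b' m) = Phi q b + PowerSeries.C c * Phi q b' := by
    intro b b'
    ext n
    simp only [Phi, PowerSeries.coeff_mk, PowerSeries.coeff_C_mul, Finset.mul_sum, map_add,
      ← Finset.sum_add_distrib]
    refine Finset.sum_congr rfl fun ν _ => ?_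
    ring
  have hconv : ∀ b : ℕ → P, ∀ m, ∑ p ∈ Finset.HasAntidiagonal.antidiagonal (m + 1), ((m + 1).choose p.1 : P) * c ^ p.1 * b p.2
      = (∑ p ∈ Finset.HasAntidiagonal.antidiagonal m, (m.choose p.1 : P) * c ^ p.1 * b (p.2 + 1)) +
        c * ∑ p ∈ Finset.HasAntidiagonal.antidiagonal m, (m.choose p.1 : P) * c ^ p.1 * b p.2 := by
    intro b m
    have := Finset.sum_antidiagonal_choose_succ_mul (R := P) (fun i j => c ^ i * b j) m
    simp only [← mul_assoc] at this
    rw [this]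
    congr 1
    rw [Finset.mul_sum]
    refine Finset.sum_congr rfl fun p hp => ?_
    have h := Finset.HasAntidiagonal.mem_antidiagonal.1 hp
    rw [Nat.choose_symm_of_eq_add h.symm]
    ring
  ext n
  induction n using Nat.strong_induction_on generalizing b with
  | _ n ih =>
    rcases Nat.eq_zero_or_pos n with rfl | hn
    · rw [PowerSeries.coeff_mul]
      simp [coeff_zero_Phi]
    · have hne : (n : P) ≠ 0 := by exact_mod_cast hn.ne'
      apply mul_left_cancel₀ hne
      have e : ∀ f : PowerSeries P, (n : P) * PowerSeries.coeff n f = PowerSeries.coeff n (theta f) := by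
        intro f; simp [theta]
      rw [e, e, theta_mul, theta_Phi q hq, theta_Phi q hq, theta_Phi q hq, hE]
      simp only [hconv]
      rw [hadd]
      have : PowerSeries.mk q * (PowerSeries.C c * Phi q fun m => c ^ m) * Phi q b +
        (Phi q fun m => c ^ m) * (PowerSeries.mk q * Phi q fun m => b (m + 1)) =
        PowerSeries.mk q * ((Phi q fun m => c ^ m) * Phi q (fun m => b (m + 1)) +
          PowerSeries.C c * ((Phi q fun m => c ^ m) * Phi q b)) := by ring
      rw [this, PowerSeries.coeff_mul, PowerSeries.coeff_mul]
      refine Finset.sum_congr rfl fun p hp => ?_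
      rcases Nat.eq_zero_or_pos p.1 with h | h
      · rw [h, hM, zero_mul, zero_mul]
      · have hlt : p.2 < n := by have := Finset.HasAntidiagonal.mem_antidiagonal.1 hp; omega
        simp only [map_add, PowerSeries.coeff_C_mul]
        rw [ih p.2 hlt, ih p.2 hlt]

/-! Descents as products -/

theorem X_pow_desc {R : Type} [CommRing R] (t : R) {n k : ℕ} (w : Fin (n + 1) → Fin k) :
    t ^ desc w = ∏ i : Fin n, if w i.succ < w i.castSucc then t else 1 := by
  unfold desc
  rw [← Finset.prod_const, Finset.prod_filter, Fin.prod_univ_castSucc]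
  simp only [Fin.val_last, lt_self_iff_false, IsEmpty.exists_iff, if_false, mul_one]
  refine Finset.prod_congr rfl fun i _ => ?_
  congr 1
  simp only [Fin.val_castSucc, eq_iff_iff]
  constructor
  · rintro ⟨h, h'⟩; exact h'
  · intro h; exact ⟨by omega, h⟩

/-! Eulerian polynomials -/

def consPerm {m : ℕ} (p : Fin (m + 2)) (τ : Equiv.Perm (Fin (m + 1))) :
    Equiv.Perm (Fin (m + 2)) :=
  Equiv.ofBijective (Fin.cons p (fun i => p.succAbove (τ i)) : Fin (m + 2) → Fin (m + 2))
    (by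
      rw [← Finite.injective_iff_bijective, Fin.cons_injective_iff]
      refine ⟨?_, Fin.succAbove_right_injective.comp τ.injective⟩
      rintro ⟨i, hi⟩
      exact Fin.succAbove_ne _ _ hi)

theorem consPerm_bij (m : ℕ) :
    Function.Bijective (fun x : Fin (m + 2) × Equiv.Perm (Fin (m + 1)) => consPerm x.1 x.2) := by
  rw [Fintype.bijective_iff_injective_and_card]
  constructor
  · rintro ⟨p, τ⟩ ⟨p', τ'⟩ h
    have h1 : p = p' := by
      have := congrArg (fun e : Equiv.Perm _ => e 0) h
      simpa [consPerm] using this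
    subst h1
    refine Prod.ext rfl (Equiv.ext fun i => ?_)
    have := congrArg (fun e : Equiv.Perm _ => e i.succ) h
    simpa [consPerm] using this
  · simp [Fintype.card_perm, Nat.factorial_succ]

theorem desc_consPerm {R : Type} [CommRing R] (t : R) {m : ℕ} (p : Fin (m + 2)) (τ : Equiv.Perm (Fin (m + 1))) :
    t ^ desc ⇑(consPerm p τ) = (if (τ 0).castSucc < p then t else 1) * t ^ desc ⇑τ := by
  rw [X_pow_desc, X_pow_desc, Fin.prod_univ_succ]
  congr 1
  · simp only [consPerm, Equiv.ofBijective_apply, Fin.castSucc_zero, Fin.cons_zero, Fin.cons_succ]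
    simp only [Fin.succAbove_lt_iff_castSucc_lt]
  · refine Finset.prod_congr rfl fun i _ => ?_
    simp only [consPerm, Equiv.ofBijective_apply, Fin.cons_succ, ← Fin.succ_castSucc]
    simp only [Fin.succAbove_lt_succAbove_iff]

/-- Eulerian polynomials refined by the first value -/
def eulFirst (R : Type) [CommRing R] (m : ℕ) (p : Fin (m + 1)) : Polynomial R :=
  ∑ σ : Equiv.Perm (Fin (m + 1)), if σ 0 = p then Polynomial.X ^ desc ⇑σ else 0

theorem eulFirst_succ (R : Type) [CommRing R] (m : ℕ) (p : Fin (m + 2)) :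
    eulFirst R (m + 1) p =
      ∑ q : Fin (m + 1), (if q.castSucc < p then Polynomial.X else 1) * eulFirst R m q := by
  unfold eulFirst
  rw [← Function.Bijective.sum_comp (consPerm_bij m), Fintype.sum_prod_type]
  simp only [desc_consPerm]
  have h0 : ∀ (x : Fin (m + 2)) (τ : Equiv.Perm (Fin (m + 1))), consPerm x τ 0 = x := by
    intro x τ; simp [consPerm]
  simp only [h0, Finset.mul_sum]
  rw [Finset.sum_comm]
  rw [Finset.sum_comm (s := (Finset.univ : Finset (Fin (m + 1))))]
  refine Finset.sum_congr rfl fun τ _ => ?_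
  simp

theorem eul_eq_eulFirst (R : Type) [CommRing R] (m : ℕ) :
    Eul R (m + 1) = eulFirst R (m + 1) 0 := by
  rw [eulFirst_succ]
  simp only [eulFirst, Eul, Fin.not_lt_zero, if_false, one_mul]
  rw [Finset.sum_comm]
  simp

theorem pow_sub_pow_sum {R : Type} [CommRing R] (j : R) (a b : ℕ) (h : a ≤ b) :
    ∑ q ∈ Finset.Ico a b, j ^ q * (j + 1) ^ (b - 1 - q) = j ^ a * ((j + 1) ^ (b - a) - j ^ (b - a)) := by
  obtain ⟨c, rfl⟩ := Nat.exists_eq_add_of_le h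
  rw [Finset.sum_Ico_eq_sum_range]
  have := (Commute.all (j + 1) j).geom_sum₂_mul (n := c)
  simp only [add_tsub_cancel_left]
  rw [← this, add_sub_cancel_left, mul_one, Finset.mul_sum]
  rw [← Finset.sum_range_reflect]
  refine Finset.sum_congr rfl fun i hi => ?_
  have hi := Finset.mem_range.1 hi
  rw [pow_add, show a + c - 1 - (a + (c - 1 - i)) = i by omega]
  ring

theorem eulFirst_series (R : Type) [CommRing R] (m : ℕ) (p : Fin (m + 1)) :
    (eulFirst R m p : PowerSeries R) = (1 - PowerSeries.X) ^ (m + 1) *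
      PowerSeries.mk fun j => (j : R) ^ (p : ℕ) * (j + 1) ^ (m - p) := by
  induction m with
  | zero =>
    have hp : p = 0 := Fin.eq_zero p
    subst hp
    have : eulFirst R 0 0 = 1 := by
      unfold eulFirst
      have hu : ∀ σ : Equiv.Perm (Fin (0 + 1)), σ = 1 := fun σ => Equiv.ext fun i => by
        rw [Fin.eq_zero (σ i), Fin.eq_zero i]; rfl
      rw [Fintype.sum_eq_single 1 fun σ h => absurd (hu σ) h]
      rw [if_pos (show (1 : Equiv.Perm (Fin (0 + 1))) 0 = 0 from rfl), X_pow_desc]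
      simp
    rw [this]
    simp only [Fin.val_zero, pow_zero, zero_tsub, one_mul, zero_add, pow_one, Polynomial.coe_one]
    have := PowerSeries.mk_one_mul_one_sub_eq_one R
    rw [mul_comm]; exact this.symm
  | succ m ih =>
    rw [eulFirst_succ]
    have e1 : ((∑ q : Fin (m + 1), (if q.castSucc < p then Polynomial.X else 1) * eulFirst R m q : Polynomial R) : PowerSeries R)
      = ∑ q : Fin (m + 1), (if q.castSucc < p then PowerSeries.X else 1) * (eulFirst R m q : PowerSeries R) := by
      rw [← Polynomial.coeToPowerSeries.ringHom_apply, map_sum]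
      refine Finset.sum_congr rfl fun q _ => ?_
      rw [Polynomial.coeToPowerSeries.ringHom_apply, Polynomial.coe_mul]
      split_ifs <;> simp
    rw [e1]
    simp only [ih]
    rw [pow_succ _ (m + 1), mul_assoc]
    simp only [mul_left_comm _ ((1 - PowerSeries.X : PowerSeries R) ^ (m + 1))]
    rw [← Finset.mul_sum]
    congr 1
    have hsum : ∀ f : ℕ → PowerSeries R, ∑ q : Fin (m + 1), (if q.castSucc < p then PowerSeries.X else 1) * f q
        = PowerSeries.X * (∑ q ∈ Finset.Ico 0 (p : ℕ), f q) + ∑ q ∈ Finset.Ico (p : ℕ) (m + 1), f q := by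
      intro f
      have hh := Fin.sum_univ_eq_sum_range (fun q => (if q < (p : ℕ) then PowerSeries.X else 1) * f q) (m + 1)
      have : ∀ q : Fin (m + 1), (q.castSucc < p) = ((q : ℕ) < (p : ℕ)) := by
        intro q; rfl
      simp only [this]
      rw [hh, Finset.range_eq_Ico, ← Finset.sum_Ico_consecutive _ (Nat.zero_le (p : ℕ)) (Nat.lt_succ_iff.1 p.2), Finset.mul_sum]
      congr 1
      · refine Finset.sum_congr rfl fun i hi => ?_
        rw [if_pos (Finset.mem_Ico.1 hi).2]
      · refine Finset.sum_congr rfl fun i hi => ?_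
        rw [if_neg (by have := (Finset.mem_Ico.1 hi).1; omega), one_mul]
    rw [hsum fun q => PowerSeries.mk fun j : ℕ => (j : R) ^ q * (j + 1) ^ (m - q)]
    have hp : (p : ℕ) ≤ m + 1 := Nat.lt_succ_iff.1 p.2
    have hA : ∑ q ∈ Finset.Ico (p : ℕ) (m + 1), (PowerSeries.mk fun j : ℕ => (j : R) ^ q * (j + 1) ^ (m - q)) =
        PowerSeries.mk fun j : ℕ => (j : R) ^ (p : ℕ) * (((j : R) + 1) ^ (m + 1 - p) - (j : R) ^ (m + 1 - p)) := by
      ext j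
      rw [map_sum]
      simp only [PowerSeries.coeff_mk]
      rw [← pow_sub_pow_sum _ _ _ hp]
      simp
    have hB : ∑ q ∈ Finset.Ico 0 (p : ℕ), (PowerSeries.mk fun j : ℕ => (j : R) ^ q * (j + 1) ^ (m - q)) =
        PowerSeries.mk fun j : ℕ => ((j : R) + 1) ^ (m + 1 - p) * (((j : R) + 1) ^ (p : ℕ) - (j : R) ^ (p : ℕ)) := by
      ext j
      rw [map_sum]
      simp only [PowerSeries.coeff_mk]
      have := pow_sub_pow_sum (j : R) 0 p (Nat.zero_le _)
      simp only [pow_zero, one_mul, Nat.sub_zero] at this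
      rw [← this, Finset.mul_sum]
      refine Finset.sum_congr rfl fun q hq => ?_
      have := (Finset.mem_Ico.1 hq).2
      rw [mul_left_comm, ← pow_add]
      congr 2; omega
    rw [hA, hB, sub_mul, one_mul]
    ext j
    obtain ⟨c, hc⟩ := Nat.exists_eq_add_of_le hp
    have hc' : m + 1 - (p : ℕ) = c := by omega
    rw [hc']
    rcases j with _ | j
    · simp only [map_add, map_sub, PowerSeries.coeff_zero_X_mul, PowerSeries.coeff_mk, Nat.cast_zero, zero_add, one_pow, mul_sub, mul_one, sub_zero, ← pow_add, ← hc]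
      simp
    · simp only [map_add, map_sub, PowerSeries.coeff_succ_X_mul, PowerSeries.coeff_mk, Nat.cast_succ]
      have e1 : ((j : R) + 1) ^ c * ((j : R) + 1) ^ (p : ℕ) = ((j : R) + 1) ^ (p : ℕ) * ((j : R) + 1) ^ c := mul_comm _ _
      ring

theorem eul_series (R : Type) [CommRing R] (m : ℕ) :
    (Eul R m : PowerSeries R) = (1 - PowerSeries.X) ^ (m + 1) *
      PowerSeries.mk fun j => ((j : R) + 1) ^ m := by
  rcases m with _ | m
  · have : Eul R 0 = 1 := by
      unfold Eul
      rw [Fintype.sum_unique]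
      simp [desc]
    rw [this]
    simp only [pow_zero, zero_add, pow_one, Polynomial.coe_one]
    have := PowerSeries.mk_one_mul_one_sub_eq_one R
    rw [mul_comm]; exact this.symm
  · rw [eul_eq_eulFirst, eulFirst_series]
    simp

/-- the sequence `1, t A_1, t A_2, ...` -/
def alpha (R : Type) [CommRing R] (m : ℕ) : Polynomial R :=
  if m = 0 then 1 else Polynomial.X * Eul R m

theorem alpha_series (R : Type) [CommRing R] (m : ℕ) :
    (alpha R m : PowerSeries R) = (1 - PowerSeries.X) ^ (m + 1) *
      PowerSeries.mk fun j => (j : R) ^ m := by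
  unfold alpha
  split_ifs with h
  · subst h
    simp only [pow_zero, zero_add, pow_one, Polynomial.coe_one]
    have := PowerSeries.mk_one_mul_one_sub_eq_one R
    rw [mul_comm]; exact this.symm
  · rw [Polynomial.coe_mul, Polynomial.coe_X, eul_series, mul_left_comm]
    congr 1
    ext j
    rcases j with _ | j
    · simp [h]
    · simp [PowerSeries.coeff_succ_X_mul]

theorem alpha_rec (R : Type) [CommRing R] (m : ℕ) :
    Polynomial.X * ∑ p ∈ Finset.HasAntidiagonal.antidiagonal m,
      (m.choose p.1 : Polynomial R) * (1 - Polynomial.X) ^ p.1 * alpha R p.2 =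
    alpha R m - if m = 0 then 1 - Polynomial.X else 0 := by
  apply Polynomial.coe_injective R
  have e : ∀ f : Polynomial R, (f : PowerSeries R) = Polynomial.coeToPowerSeries.ringHom f := fun f => rfl
  have hmain : (PowerSeries.X : PowerSeries R) * PowerSeries.mk (fun j => ((j : R) + 1) ^ m)
      = PowerSeries.mk (fun j => (j : R) ^ m) - if m = 0 then 1 else 0 := by
    ext j
    rcases j with _ | j
    · rcases m with _ | m <;> simp
    · rcases m with _ | m <;> simp [PowerSeries.coeff_succ_X_mul, PowerSeries.coeff_one]
  have hL : Polynomial.coeToPowerSeries.ringHom (∑ p ∈ Finset.HasAntidiagonal.antidiagonal m,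
      (m.choose p.1 : Polynomial R) * (1 - Polynomial.X) ^ p.1 * alpha R p.2) =
      (1 - PowerSeries.X) ^ (m + 1) * PowerSeries.mk (fun j => ((j : R) + 1) ^ m) := by
    rw [map_sum]
    have : ∀ p ∈ Finset.HasAntidiagonal.antidiagonal m, Polynomial.coeToPowerSeries.ringHom ((m.choose p.1 : Polynomial R) * (1 - Polynomial.X) ^ p.1 * alpha R p.2)
       = (1 - PowerSeries.X) ^ (m + 1) * ((m.choose p.1 : PowerSeries R) * PowerSeries.mk (fun j => (j : R) ^ p.2)) := by
      intro p hp
      have h := Finset.HasAntidiagonal.mem_antidiagonal.1 hp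
      rw [map_mul, map_mul, map_pow, map_sub, map_one, map_natCast, ← e (alpha R p.2), alpha_series, ← e, Polynomial.coe_X, ← h]
      ring
    rw [Finset.sum_congr rfl this, ← Finset.mul_sum]
    congr 1
    ext j
    rw [map_sum, PowerSeries.coeff_mk, add_comm, (Commute.all (1:R) (j : R)).add_pow']
    refine Finset.sum_congr rfl fun p _ => ?_
    rw [← nsmul_eq_mul, map_nsmul]
    simp
  have hr : ((alpha R m - if m = 0 then 1 - Polynomial.X else 0 : Polynomial R) : PowerSeries R)
     = (alpha R m : PowerSeries R) - if m = 0 then 1 - PowerSeries.X else 0 := by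
    rw [e, map_sub, ← e]
    split_ifs <;> simp
  rw [hr, alpha_series, e, map_mul, hL, ← e, Polynomial.coe_X, mul_left_comm, hmain]
  split_ifs with h
  · subst h; ring
  · ring

/-! Transfer-matrix argument -/

theorem transfer_identity {S : Type} [CommRing S] [IsDomain S] (k : ℕ) (t : S) (X : ℕ → S)
    (G : ℕ → ℕ → S) (hX : ∀ a, 1 + X a ≠ 0) (hX' : ∀ a, 1 + t * X a ≠ 0)
    (hG : ∀ a < k, ∀ b < k, G a b = X b * ((if a = b then 1 else 0) +
      ∑ c ∈ Finset.range k, (if c < b then 1 else if b < c then t else 0) * G a c)) :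
    (1 - t) * (∑ a ∈ Finset.range k, ∑ b ∈ Finset.Ico (a + 1) k, G a b) *
      (∏ c ∈ Finset.range k, (1 + t * X c) - t * ∏ c ∈ Finset.range k, (1 + X c)) =
    ∏ c ∈ Finset.range k, (1 + X c) - ∏ c ∈ Finset.range k, (1 + t * X c)
     - (1 - t) * ∑ a ∈ Finset.range k, X a * ∏ c ∈ (Finset.range k).erase a, (1 + t * X c) := by
  set Et := ∏ c ∈ Finset.range k, (1 + t * X c) with hEt
  set E1 := ∏ c ∈ Finset.range k, (1 + X c) with hE1
  let pi : ℕ → S := fun b => (∏ c ∈ Finset.range b, (1 + t * X c)) * ∏ c ∈ Finset.Ico b k, (1 + X c)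
  let rho : ℕ → S := fun b => (∏ c ∈ Finset.range b, (1 + t * X c)) * ∏ c ∈ Finset.Ico (b + 1) k, (1 + X c)
  let eta : ℕ → S := fun a => ∏ c ∈ (Finset.range k).erase a, (1 + t * X c)
  have hpi0 : pi 0 = E1 := by simp [pi, hE1]
  have hpik : pi k = Et := by simp [pi, hEt]
  have hpi : ∀ b < k, pi b = (1 + X b) * rho b := by
    intro b hb
    simp only [pi, rho]
    rw [Finset.prod_eq_prod_Ico_succ_bot hb]; ring
  have hpi' : ∀ b, pi (b + 1) = (1 + t * X b) * rho b := by
    intro b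
    simp only [pi, rho]
    rw [Finset.prod_range_succ]; ring
  have hrho : ∀ b, rho b ≠ 0 := fun b =>
    mul_ne_zero (Finset.prod_ne_zero_iff.2 fun c _ => hX' c) (Finset.prod_ne_zero_iff.2 fun c _ => hX c)
  have heta : ∀ a < k, Et = (1 + t * X a) * eta a := by
    intro a ha
    exact (Finset.mul_prod_erase _ _ (Finset.mem_range.2 ha)).symm
  have hEt0 : Et ≠ 0 := Finset.prod_ne_zero_iff.2 fun c _ => hX' c
  -- partial sums
  let Sm : ℕ → ℕ → S := fun a b => ∑ c ∈ Finset.range b, G a c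
  have hrec : ∀ a < k, ∀ b < k, G a b * (1 + t * X b) = X b * ((if a = b then 1 else 0) + (1 - t) * Sm a b + t * Sm a k) := by
    intro a ha b hb
    have h1 : ∑ c ∈ Finset.range k, (if c < b then 1 else if b < c then t else 0) * G a c
        = Sm a b + t * (Sm a k - Sm a b - G a b) := by
      have e1 : Sm a k = Sm a b + G a b + ∑ c ∈ Finset.Ico (b + 1) k, G a c := by
        simp only [Sm]
        rw [← Finset.sum_range_succ, Finset.sum_range_add_sum_Ico _ (by omega)]
      rw [e1, ← Finset.sum_range_add_sum_Ico _ (show b + 1 ≤ k by omega), Finset.sum_range_succ]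
      have e2 : ∑ c ∈ Finset.range b, (if c < b then 1 else if b < c then t else 0) * G a c = Sm a b :=
        Finset.sum_congr rfl fun c hc => by rw [if_pos (Finset.mem_range.1 hc), one_mul]
      have e3 : ∑ c ∈ Finset.Ico (b + 1) k, (if c < b then 1 else if b < c then t else 0) * G a c
          = t * ∑ c ∈ Finset.Ico (b + 1) k, G a c := by
        rw [Finset.mul_sum]
        refine Finset.sum_congr rfl fun c hc => ?_
        have := (Finset.mem_Ico.1 hc).1
        rw [if_neg (by omega), if_pos (by omega)]
      rw [e2, e3]
      simp only [lt_self_iff_false, if_false]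
      ring
    have := hG a ha b hb
    rw [h1] at this
    linear_combination this
  let U : ℕ → ℕ → S := fun a b => (1 - t) * Sm a b + t * Sm a k
  have hU : ∀ a < k, ∀ b < k, U a (b + 1) * pi (b + 1) = U a b * pi b + if a = b then (1 - t) * X b * rho b else 0 := by
    intro a ha b hb
    have e : Sm a (b + 1) = Sm a b + G a b := Finset.sum_range_succ _ _
    have := hrec a ha b hb
    simp only [U]
    rw [hpi b hb, hpi' b, e]
    split_ifs at this ⊢
    · linear_combination (1 - t) * rho b * this
    · linear_combination (1 - t) * rho b * this
  have hUlow : ∀ a < k, ∀ b ≤ a, U a b * pi b = U a 0 * pi 0 := by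
    intro a ha b
    induction b with
    | zero => intro _; rfl
    | succ b ih =>
      intro hb
      rw [hU a ha b (by omega), if_neg (by omega), add_zero, ih (by omega)]
  have hUhigh : ∀ a < k, ∀ b, a + 1 ≤ b → b ≤ k → U a b * pi b = U a (a + 1) * pi (a + 1) := by
    intro a ha b hb
    induction b, hb using Nat.le_induction with
    | base => intro _; rfl
    | succ b hb ih =>
      intro hbk
      rw [hU a ha b (by omega), if_neg (by omega), add_zero, ih (by omega)]
  have hU0 : ∀ a, U a 0 = t * Sm a k := by intro a; simp [U, Sm]
  have hUk : ∀ a, U a k = Sm a k := by intro a; simp only [U]; ring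
  have hmid : ∀ a < k, Sm a k * Et = t * Sm a k * E1 + (1 - t) * X a * rho a := by
    intro a ha
    have h1 := hUhigh a ha k (by omega) le_rfl
    have h2 := hU a ha a ha
    rw [if_pos rfl, hUlow a ha a le_rfl] at h2
    rw [hUk, hpik, h2, hU0, hpi0] at h1
    exact h1
  have hper : ∀ a < k, (1 - t) * (∑ b ∈ Finset.Ico (a + 1) k, G a b) * (Et - t * E1) * Et
      = (1 - t) * X a * eta a * (pi (a + 1) - Et) := by
    intro a ha
    have h1 := hUhigh a ha k (by omega) le_rfl
    rw [hUk, hpik] at h1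
    have h2 := hmid a ha
    have e1 : Sm a k = Sm a (a + 1) + ∑ b ∈ Finset.Ico (a + 1) k, G a b :=
      (Finset.sum_range_add_sum_Ico _ (by omega)).symm
    have e2 : (1 - t) * (∑ b ∈ Finset.Ico (a + 1) k, G a b) = Sm a k - U a (a + 1) := by
      simp only [U]; rw [e1]; ring
    rw [e2]
    apply mul_left_cancel₀ (hrho a)
    have h3 := heta a ha
    have h4 := hpi' a
    calc rho a * ((Sm a k - U a (a + 1)) * (Et - t * E1) * Et)
        = rho a * ((Sm a k - U a (a + 1)) * (Et - t * E1) * ((1 + t * X a) * eta a)) := by rw [← h3]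
      _ = (Sm a k * pi (a + 1) - U a (a + 1) * pi (a + 1)) * (Et - t * E1) * eta a := by rw [h4]; ring
      _ = Sm a k * (pi (a + 1) - Et) * (Et - t * E1) * eta a := by rw [← h1]; ring
      _ = (Sm a k * Et - t * Sm a k * E1) * (pi (a + 1) - Et) * eta a := by ring
      _ = rho a * ((1 - t) * X a * eta a * (pi (a + 1) - Et)) := by rw [h2]; ring
  have htel : (1 - t) * ∑ a ∈ Finset.range k, X a * rho a = E1 - Et := by
    rw [← hpi0, ← hpik, Finset.mul_sum, ← neg_sub (pi k), ← Finset.sum_range_sub, ← Finset.sum_neg_distrib]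
    refine Finset.sum_congr rfl fun a ha => ?_
    rw [hpi a (Finset.mem_range.1 ha), hpi']
    ring
  apply mul_right_cancel₀ hEt0
  rw [Finset.mul_sum, Finset.sum_mul, Finset.sum_mul, Finset.sum_congr rfl fun a ha => hper a (Finset.mem_range.1 ha)]
  rw [← htel, sub_mul, Finset.mul_sum, Finset.mul_sum, Finset.sum_mul, Finset.sum_mul, ← Finset.sum_sub_distrib]
  refine Finset.sum_congr rfl fun a ha => ?_
  have h3 := heta a (Finset.mem_range.1 ha)
  change _ = (1 - t) * (X a * rho a) * Et - (1 - t) * (X a * eta a) * Et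
  rw [hpi']
  have : (1 - t) * X a * eta a * ((1 + t * X a) * rho a - Et) = (1 - t) * X a * rho a * ((1 + t * X a) * eta a) - (1 - t) * X a * eta a * Et := by ring
  rw [this, ← h3]; ring

/-! Words -/

section words
variable (k : ℕ)

/-- transition weight -/
def mwt (c b : Fin k) : Polynomial (MvPolynomial (Fin k) ℚ) :=
  if c < b then 1 else if b < c then Polynomial.X else 0

def wwt {n : ℕ} (w : Fin (n + 1) → Fin k) : Polynomial (MvPolynomial (Fin k) ℚ) :=
  (∏ i : Fin n, mwt k (w i.castSucc) (w i.succ)) * ∏ i, Polynomial.C (MvPolynomial.X (w i))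

def LL (n : ℕ) (a b : Fin k) : Polynomial (MvPolynomial (Fin k) ℚ) :=
  ∑ w : Fin (n + 1) → Fin k, if w 0 = a ∧ w (Fin.last n) = b then wwt k w else 0

theorem smirnov_wwt {n : ℕ} (w : Fin (n + 1) → Fin k) :
    (if IsSmirnov w then Polynomial.X ^ desc w * Polynomial.C (xw ℚ w) else 0) = wwt k w := by
  unfold wwt
  split_ifs with h
  · rw [X_pow_desc, xw, map_prod]
    congr 1
    refine Finset.prod_congr rfl fun i _ => ?_
    have hne : w i.succ ≠ w i.castSucc := h i.castSucc (by simp)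
    unfold mwt
    rcases lt_or_gt_of_ne hne with h1 | h1
    · rw [if_pos h1, if_neg (not_lt_of_gt h1), if_pos h1]
    · rw [if_neg (not_lt_of_gt h1), if_pos h1]
  · unfold IsSmirnov at h
    push Not at h
    obtain ⟨i, hi, he⟩ := h
    symm
    apply mul_eq_zero_of_left
    refine Finset.prod_eq_zero (Finset.mem_univ (⟨i, by omega⟩ : Fin n)) ?_
    have e1 : w (Fin.succ ⟨i, by omega⟩) = w (Fin.castSucc ⟨i, by omega⟩) := he
    rw [e1]
    simp [mwt]

theorem smirnovEnum_LL (n : ℕ) :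
    smirnovEnum ℚ (n + 1) k desc FirstLtLast =
      ∑ a : Fin k, ∑ b : Fin k, if a < b then LL k n a b else 0 := by
  unfold smirnovEnum
  have h1 : ∑ w ∈ Finset.univ.filter (fun w : Fin (n + 1) → Fin k => IsSmirnov w ∧ FirstLtLast w),
      Polynomial.X ^ desc w * Polynomial.C (xw ℚ w) =
      ∑ w : Fin (n + 1) → Fin k, if w 0 < w (Fin.last n) then wwt k w else 0 := by
    rw [Finset.sum_filter]
    refine Finset.sum_congr rfl fun w _ => ?_
    rw [← smirnov_wwt]
    have : FirstLtLast w ↔ w 0 < w (Fin.last n) := by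
      constructor
      · rintro ⟨_, h⟩; exact h
      · intro h; exact ⟨by omega, h⟩
    by_cases hs : IsSmirnov w <;> by_cases hf : w 0 < w (Fin.last n) <;> simp [hs, hf, this]
  rw [h1]
  unfold LL
  have h2 : ∀ a b : Fin k, (if a < b then ∑ w : Fin (n + 1) → Fin k, (if w 0 = a ∧ w (Fin.last n) = b then wwt k w else 0) else 0)
     = ∑ w : Fin (n + 1) → Fin k, if w 0 = a then (if w (Fin.last n) = b then (if a < b then wwt k w else 0) else 0) else 0 := by
    intro a b
    split_ifs with h
    · refine Finset.sum_congr rfl fun w _ => ?_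
      rw [ite_and]
    · simp
  simp only [h2]
  rw [Finset.sum_congr rfl fun a _ => Finset.sum_comm, Finset.sum_comm]
  refine Finset.sum_congr rfl fun w _ => ?_
  rw [Finset.sum_comm]
  simp

theorem LL_zero (a b : Fin k) : LL k 0 a b = if a = b then Polynomial.C (MvPolynomial.X b) else 0 := by
  unfold LL
  rw [← (Equiv.funUnique (Fin 1) (Fin k)).symm.sum_comp]
  simp only [wwt]
  simp only [Equiv.funUnique, Finset.univ_eq_empty, Finset.prod_empty, one_mul]
  rw [Finset.sum_eq_single b]
  · simp [eq_comm]
  · intro c _ hc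
    simp [hc]
  · simp

theorem LL_succ (n : ℕ) (a b : Fin k) :
    LL k (n + 1) a b = Polynomial.C (MvPolynomial.X b) * ∑ c, mwt k c b * LL k n a c := by
  unfold LL
  rw [← (Fin.snocEquiv (fun _ : Fin (n + 2) => Fin k)).sum_comp, Fintype.sum_prod_type]
  have hw : ∀ (x : Fin k) (w : Fin (n + 1) → Fin k),
      wwt k (Fin.snocEquiv (fun _ : Fin (n + 2) => Fin k) (x, w)) = Polynomial.C (MvPolynomial.X x) * (mwt k (w (Fin.last n)) x * wwt k w) := by
    intro x w
    unfold wwt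
    rw [Fin.prod_univ_castSucc, Fin.prod_univ_castSucc (n := n + 1)]
    simp only [Fin.snocEquiv, Equiv.coe_fn_mk, Fin.snoc_castSucc, Fin.snoc_last, Fin.succ_last, ← Fin.castSucc_succ]
    ring
  have h0 : ∀ (x : Fin k) (w : Fin (n + 1) → Fin k), Fin.snocEquiv (fun _ : Fin (n + 2) => Fin k) (x, w) 0 = w 0 := by
    intro x w
    exact Fin.snoc_castSucc (α := fun _ : Fin (n + 2) => Fin k) x w 0
  have h1 : ∀ (x : Fin k) (w : Fin (n + 1) → Fin k), Fin.snocEquiv (fun _ : Fin (n + 2) => Fin k) (x, w) (Fin.last (n + 1)) = x := by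
    intro x w
    exact Fin.snoc_last (α := fun _ : Fin (n + 2) => Fin k) x w
  simp only [hw, h0, h1]
  rw [Finset.sum_comm]
  simp only [Finset.mul_sum]
  rw [Finset.sum_comm (s := (Finset.univ : Finset (Fin k)))]
  refine Finset.sum_congr rfl fun w _ => ?_
  rw [Finset.sum_eq_single b, Finset.sum_eq_single (w (Fin.last n))]
  · by_cases h : w 0 = a <;> simp [h]
  · intro c _ hc; simp [Ne.symm hc]
  · simp
  · intro c _ hc; simp [hc]
  · simp

end words

/-! Assembling -/

theorem neg_one_pow_self (R : Type) [CommRing R] (n : ℕ) : (-1 : R) ^ n * (-1) ^ n = 1 := by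
  rw [← mul_pow, neg_mul_neg, one_mul, one_pow]

theorem neg_one_pow_add_two (R : Type) [CommRing R] (d m : ℕ) :
    (-1 : R) ^ (d + 2 * m) = (-1) ^ d := by
  rw [pow_add, pow_mul, neg_one_sq, one_pow, mul_one]

section final
variable (k : ℕ)

/-- `t` as a constant series -/
def tt : PowerSeries (Polynomial (MvPolynomial (Fin k) ℚ)) := PowerSeries.C Polynomial.X

def Eser (c : Polynomial (MvPolynomial (Fin k) ℚ)) :
    PowerSeries (Polynomial (MvPolynomial (Fin k) ℚ)) :=
  PowerSeries.mk fun n => c ^ n * Polynomial.C (esymm (Fin k) ℚ n)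

def Nser (c : Polynomial (MvPolynomial (Fin k) ℚ)) :
    PowerSeries (Polynomial (MvPolynomial (Fin k) ℚ)) :=
  PowerSeries.mk fun n => if n = 0 then 0 else
    c ^ n * ((-1) ^ (n + 1) * Polynomial.C (psum (Fin k) ℚ n))

theorem theta_Eser (c : Polynomial (MvPolynomial (Fin k) ℚ)) :
    theta (Eser k c) = Nser k c * Eser k c := by
  ext1 n
  rw [mul_comm]
  simp only [theta, Eser, Nser, PowerSeries.coeff_mk, PowerSeries.coeff_mul]
  have h := congrArg (Polynomial.C) (MvPolynomial.mul_esymm_eq_sum (Fin k) ℚ n)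
  rw [map_mul, map_mul, map_sum, map_natCast, map_pow, map_neg, map_one] at h
  rw [mul_left_comm, h, Finset.mul_sum, Finset.sum_filter, Finset.mul_sum]
  refine Finset.sum_congr rfl fun p hp => ?_
  have hp := Finset.HasAntidiagonal.mem_antidiagonal.1 hp
  by_cases h0 : p.2 = 0
  · rw [if_neg (by omega), if_pos h0]; simp
  · rw [if_pos (by omega), if_neg h0, ← hp]
    simp only [map_mul, map_pow, map_neg, map_one]
    have : ((-1 : Polynomial (MvPolynomial (Fin k) ℚ)) ^ p.1) * (-1) ^ p.1 = 1 := neg_one_pow_self _ p.1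
    have e : ((-1 : Polynomial (MvPolynomial (Fin k) ℚ)) ^ (p.1 + p.2 + 1)) * (-1) ^ p.1 = (-1) ^ (p.2 + 1) := by
      rw [show p.1 + p.2 + 1 = p.1 + (p.2 + 1) by ring, pow_add, mul_right_comm, this, one_mul]
    rw [← e]
    ring

theorem Eser_prod (c : Polynomial (MvPolynomial (Fin k) ℚ)) :
    ∏ a : Fin k, (1 + PowerSeries.C (c * Polynomial.C (MvPolynomial.X a)) * PowerSeries.X) = Eser k c := by
  rw [Finset.prod_one_add]
  ext1 n
  have : ∀ s : Finset (Fin k), PowerSeries.coeff n (∏ a ∈ s, PowerSeries.C (c * Polynomial.C (MvPolynomial.X a)) * (PowerSeries.X : PowerSeries (Polynomial (MvPolynomial (Fin k) ℚ))))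
      = if s.card = n then c ^ n * Polynomial.C (∏ a ∈ s, (MvPolynomial.X a : MvPolynomial (Fin k) ℚ)) else 0 := by
    intro s
    rw [Finset.prod_mul_distrib, ← map_prod, Finset.prod_const, Finset.prod_mul_distrib, Finset.prod_const, PowerSeries.coeff_C_mul_X_pow, map_prod]
    by_cases h : s.card = n
    · subst h; simp
    · rw [if_neg h, if_neg (Ne.symm h)]
  rw [map_sum]
  simp only [this, Eser, PowerSeries.coeff_mk, esymm]
  rw [map_sum, Finset.mul_sum, ← Finset.sum_filter, Finset.powersetCard_eq_filter]

theorem dt_prod {A : Type} [CommRing A] (s : Finset ℕ) (f : ℕ → PowerSeries (Polynomial A)) :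
    dt (∏ a ∈ s, f a) = ∑ a ∈ s, dt (f a) * ∏ c ∈ s.erase a, f c := by
  induction s using Finset.induction_on with
  | empty => 
    ext1 n
    simp only [Finset.prod_empty, Finset.sum_empty, dt, PowerSeries.coeff_mk, PowerSeries.coeff_one, map_zero]
    split_ifs <;> simp
  | insert a s ha ih =>
    rw [Finset.prod_insert ha, dt_mul, ih, Finset.sum_insert ha, Finset.erase_insert ha, Finset.mul_sum]
    refine congrArg (fun y => dt (f a) * ∏ c ∈ s, f c + y) (Finset.sum_congr rfl fun b hb => ?_)
    have hne : a ≠ b := fun h => ha (h ▸ hb)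
    rw [Finset.erase_insert_of_ne hne, Finset.prod_insert (fun h => ha (Finset.mem_of_mem_erase h))]
    ring

theorem D_eq : (1 - tt k) * Dser ℚ k = Eser k Polynomial.X - tt k * Eser k 1 := by
  ext1 n
  have ht : tt k = PowerSeries.C Polynomial.X := rfl
  have h1 : (1 - tt k) = PowerSeries.C (1 - Polynomial.X) := by rw [ht, map_sub, map_one]
  rw [h1, ht, map_sub (PowerSeries.coeff n), PowerSeries.coeff_C_mul, PowerSeries.coeff_C_mul]
  simp only [Dser, Eser, PowerSeries.coeff_mk, one_pow, one_mul]
  rcases n with _ | _ | n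
  · simp
  · simp
  · rw [if_neg (by omega), if_neg (by omega)]
    have hg : (1 - Polynomial.X) * tnum ℚ k (n + 2 - 1) = 1 - Polynomial.X ^ (n + 1) := by
      unfold tnum
      exact mul_neg_geom_sum _ _
    linear_combination (-Polynomial.X * Polynomial.C (esymm (Fin k) ℚ (n + 2))) * hg

theorem one_sub_tt_ne : (1 - tt k) ≠ 0 := by
  intro h
  have h2 := congrArg (PowerSeries.coeff 0) h
  have ht : tt k = PowerSeries.C Polynomial.X := rfl
  rw [ht, map_sub] at h2
  have h3 := congrArg (fun p => Polynomial.coeff p 1) h2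
  simp [Polynomial.coeff_one] at h3

theorem dt_const (c : Polynomial (MvPolynomial (Fin k) ℚ)) : dt (PowerSeries.C c) = PowerSeries.C (Polynomial.derivative c) := by
  ext1 n
  simp only [dt, PowerSeries.coeff_mk, PowerSeries.coeff_C]
  split_ifs <;> simp

theorem dt_tt : dt (tt k) = 1 := by
  rw [tt, dt_const]; simp

theorem dt_one : dt (1 : PowerSeries (Polynomial (MvPolynomial (Fin k) ℚ))) = 0 := by
  have := dt_const k 1
  simpa using this

theorem dt_E1 : dt (Eser k 1) = 0 := by
  ext1 n; simp [dt, Eser]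

theorem dt_N1 : dt (Nser k 1) = 0 := by
  ext1 n
  simp only [dt, Nser, PowerSeries.coeff_mk]
  split_ifs
  · simp
  · have : ((-1 : Polynomial (MvPolynomial (Fin k) ℚ)) ^ (n + 1)) = Polynomial.C ((-1) ^ (n + 1)) := by simp
    rw [one_pow, one_mul, this, ← map_mul]
    simp

/-- `(1-t)^2 D_t` -/
theorem dt_D_eq : (1 - tt k) ^ 2 * dt (Dser ℚ k) =
    Eser k Polynomial.X - Eser k 1 + (1 - tt k) * dt (Eser k Polynomial.X) := by
  have h := congrArg dt (D_eq k)
  rw [dt_mul, dt_sub, dt_sub, dt_mul, dt_one, dt_tt, dt_E1] at h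
  linear_combination (1 - tt k) * h + D_eq k

/-! word side -/

def Xn (i : ℕ) : PowerSeries (Polynomial (MvPolynomial (Fin k) ℚ)) :=
  if h : i < k then PowerSeries.C (Polynomial.C (MvPolynomial.X ⟨i, h⟩)) * PowerSeries.X else 0

def GG (a b : ℕ) : PowerSeries (Polynomial (MvPolynomial (Fin k) ℚ)) :=
  if h : a < k ∧ b < k then PowerSeries.X * PowerSeries.mk (fun n => LL k n ⟨a, h.1⟩ ⟨b, h.2⟩) else 0

theorem GG_rec (a b : ℕ) (ha : a < k) (hb : b < k) : GG k a b = Xn k b * ((if a = b then 1 else 0) +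
      ∑ c ∈ Finset.range k, (if c < b then 1 else if b < c then tt k else 0) * GG k a c) := by
  rw [Finset.sum_range]
  have h1 : ∀ c : Fin k, GG k a c = PowerSeries.X * PowerSeries.mk (fun n => LL k n ⟨a, ha⟩ c) := by
    intro c; rw [GG, dif_pos ⟨ha, c.2⟩]
  have h2 : ∀ c : Fin k, (if (c : ℕ) < b then 1 else if b < c then tt k else 0) = PowerSeries.C (mwt k c ⟨b, hb⟩) := by
    intro c
    simp only [mwt, Fin.lt_def]
    split_ifs <;> simp [tt]
  simp only [h1, h2]
  rw [GG, dif_pos ⟨ha, hb⟩, Xn, dif_pos hb, mul_comm _ PowerSeries.X, mul_assoc]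
  congr 1
  ext1 n
  rw [PowerSeries.coeff_mk, PowerSeries.coeff_C_mul, map_add, map_sum]
  rcases n with _ | n
  · rw [LL_zero]
    by_cases h : a = b
    · simp [h]
    · simp [h]
  · rw [LL_succ]
    congr 1
    have : PowerSeries.coeff (n + 1) (if a = b then (1 : PowerSeries (Polynomial (MvPolynomial (Fin k) ℚ))) else 0) = 0 := by
      split_ifs <;> simp [PowerSeries.coeff_one]
    rw [this, zero_add]
    refine Finset.sum_congr rfl fun c _ => ?_
    rw [PowerSeries.coeff_C_mul, PowerSeries.coeff_succ_X_mul, PowerSeries.coeff_mk]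

def Wser : PowerSeries (Polynomial (MvPolynomial (Fin k) ℚ)) :=
  ∑ a ∈ Finset.range k, ∑ b ∈ Finset.Ico (a + 1) k, GG k a b

theorem coeff_Wser (n : ℕ) :
    PowerSeries.coeff (n + 1) (Wser k) = smirnovEnum ℚ (n + 1) k desc FirstLtLast := by
  rw [smirnovEnum_LL, Wser, Finset.sum_range, map_sum]
  refine Finset.sum_congr rfl fun a _ => ?_
  have : ∑ b ∈ Finset.Ico ((a : ℕ) + 1) k, GG k a b = ∑ b ∈ Finset.range k, if (a : ℕ) < b then GG k a b else 0 := by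
    rw [← Finset.sum_filter]
    refine Finset.sum_congr ?_ fun _ _ => rfl
    ext i; simp only [Finset.mem_Ico, Finset.mem_filter, Finset.mem_range]; omega
  rw [this, Finset.sum_range, map_sum]
  refine Finset.sum_congr rfl fun b _ => ?_
  by_cases h : a < b
  · rw [if_pos (show (a : ℕ) < b from h), if_pos h, GG, dif_pos ⟨a.2, b.2⟩, PowerSeries.coeff_succ_X_mul, PowerSeries.coeff_mk]
  · rw [if_neg (show ¬ (a : ℕ) < b from h), if_neg h, map_zero]

theorem Wser_eq : Wser k * Dser ℚ k = - dt (Dser ℚ k) := by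
  have hXc : ∀ a, PowerSeries.coeff 0 (Xn k a) = 0 := by
    intro a; unfold Xn; split_ifs <;> simp
  have hE1 : ∏ c ∈ Finset.range k, (1 + Xn k c) = Eser k 1 := by
    rw [Finset.prod_range, ← Eser_prod]
    refine Finset.prod_congr rfl fun a _ => ?_
    rw [Xn, dif_pos a.2, one_mul]
  have hEt : ∏ c ∈ Finset.range k, (1 + tt k * Xn k c) = Eser k Polynomial.X := by
    rw [Finset.prod_range, ← Eser_prod]
    refine Finset.prod_congr rfl fun a _ => ?_
    rw [Xn, dif_pos a.2, tt, map_mul, mul_assoc]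
  have hdX : ∀ a, dt (Xn k a) = 0 := by
    intro a; unfold Xn
    split_ifs with h
    · ext1 n
      simp only [dt, PowerSeries.coeff_mk]
      rw [mul_comm]
      rcases n with _ | n
      · simp
      · rw [PowerSeries.coeff_succ_X_mul, PowerSeries.coeff_C]
        split_ifs <;> simp
    · ext1 n; simp [dt]
  have h := transfer_identity k (tt k) (Xn k) (GG k)
    (fun a h => by
      have := congrArg (PowerSeries.coeff 0) h
      rw [map_add, hXc] at this; simp at this)
    (fun a h => by
      have := congrArg (PowerSeries.coeff 0) h
      rw [map_add, tt, PowerSeries.coeff_C_mul, hXc] at this; simp at this)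
    (fun a ha b hb => GG_rec k a b ha hb)
  have hd : dt (Eser k Polynomial.X) = ∑ a ∈ Finset.range k, Xn k a * ∏ c ∈ (Finset.range k).erase a, (1 + tt k * Xn k c) := by
    rw [← hEt, dt_prod]
    refine Finset.sum_congr rfl fun a _ => ?_
    rw [dt_add, dt_mul, dt_one, dt_tt, hdX]
    congr 1; ring
  rw [hE1, hEt, ← hd, ← D_eq] at h
  change (1 - tt k) * Wser k * _ = _ at h
  have hne := one_sub_tt_ne k
  apply mul_left_cancel₀ (pow_ne_zero 2 hne)
  linear_combination h + dt_D_eq k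

/-! power sum side -/

def qq (n : ℕ) : Polynomial (MvPolynomial (Fin k) ℚ) :=
  (-1) ^ (n + 1) * tnum ℚ k n * Polynomial.C (psum (Fin k) ℚ n)

theorem qq_zero : qq k 0 = 0 := by simp [qq, tnum]

def alpha' (m : ℕ) : Polynomial (MvPolynomial (Fin k) ℚ) :=
  if m = 0 then 0 else alpha (MvPolynomial (Fin k) ℚ) (m - 1)

theorem qq_N : (tt k - 1) * PowerSeries.mk (qq k) = Nser k Polynomial.X - Nser k 1 := by
  have ht : tt k - 1 = PowerSeries.C (Polynomial.X - 1) := by simp [tt]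
  rw [ht]
  ext1 n
  rw [map_sub (PowerSeries.coeff n), PowerSeries.coeff_C_mul]
  simp only [Nser, PowerSeries.coeff_mk]
  split_ifs with h
  · subst h; simp [qq_zero]
  · have hg : (Polynomial.X - 1) * tnum ℚ k n = Polynomial.X ^ n - 1 := by
      unfold tnum; exact mul_geom_sum _ _
    simp only [qq]
    rw [one_pow]
    linear_combination ((-1) ^ (n + 1) * Polynomial.C (psum (Fin k) ℚ n)) * hg

theorem coeff_zero_N (c : Polynomial (MvPolynomial (Fin k) ℚ)) : PowerSeries.coeff 0 (Nser k c) = 0 := by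
  simp [Nser]

theorem coeff_zero_E (c : Polynomial (MvPolynomial (Fin k) ℚ)) : PowerSeries.coeff 0 (Eser k c) = 1 := by
  simp [Eser]

theorem E1_eq : Eser k Polynomial.X * Phi (qq k) (fun m => (1 - Polynomial.X) ^ m) = Eser k 1 := by
  set V := Phi (qq k) (fun m => (1 - Polynomial.X) ^ m) with hV
  have hθ : theta V = PowerSeries.mk (qq k) * ((1 - tt k) * V) := by
    rw [hV, theta_Phi _ (qq_zero k)]
    congr 1
    have ht : 1 - tt k = PowerSeries.C (1 - Polynomial.X) := by simp [tt]
    rw [ht]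
    ext1 n
    simp only [Phi, PowerSeries.coeff_mk, PowerSeries.coeff_C_mul, Finset.mul_sum]
    refine Finset.sum_congr rfl fun ν _ => ?_
    ring
  rw [← sub_eq_zero]
  refine theta_ode _ (Nser k 1) (coeff_zero_N k 1) ?_ ?_
  · rw [map_sub, PowerSeries.coeff_mul]
    simp [coeff_zero_E, hV, coeff_zero_Phi]
  · rw [theta_sub, theta_mul, theta_Eser, theta_Eser, hθ]
    linear_combination (- Eser k Polynomial.X * V) * qq_N k

theorem H1_eq : tt k * (Phi (qq k) (fun m => (1 - Polynomial.X) ^ m) * Phi (qq k) (alpha (MvPolynomial (Fin k) ℚ)))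
    = Phi (qq k) (alpha (MvPolynomial (Fin k) ℚ)) - (1 - tt k) := by
  rw [Phi_mul _ (qq_zero k)]
  have ht : 1 - tt k = PowerSeries.C (1 - Polynomial.X) := by simp [tt]
  rw [ht]
  ext1 n
  rw [tt, PowerSeries.coeff_C_mul, map_sub]
  simp only [Phi, PowerSeries.coeff_mk]
  rw [Finset.mul_sum]
  simp only [← mul_assoc (Polynomial.X : Polynomial (MvPolynomial (Fin k) ℚ)), alpha_rec, sub_mul (alpha _ _)]
  rw [Finset.sum_sub_distrib]
  congr 1
  have := coeff_zero_Phi (qq k) (fun m => if m = 0 then 1 - Polynomial.X else 0)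
  rw [PowerSeries.coeff_C]
  split_ifs with h
  · subst h
    simpa [Phi] using this
  · refine Finset.sum_eq_zero fun ν _ => ?_
    rw [if_neg, zero_mul]
    intro h0
    rw [Multiset.card_eq_zero] at h0
    have := ν.parts_sum
    rw [h0] at this
    exact h this.symm

theorem H_eq : Dser ℚ k * dt (Phi (qq k) (alpha' k)) = - dt (Dser ℚ k) := by
  set H := Phi (qq k) (alpha' k) with hH
  set H1 := Phi (qq k) (alpha (MvPolynomial (Fin k) ℚ)) with hH1
  set V := Phi (qq k) (fun m => (1 - Polynomial.X) ^ m) with hV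
  set D := Dser ℚ k with hD
  have hne := one_sub_tt_ne k
  have hθH : theta H = PowerSeries.mk (qq k) * H1 := by
    rw [hH, theta_Phi _ (qq_zero k)]
    congr 2
  have hDH1 : D * H1 = Eser k Polynomial.X := by
    apply mul_left_cancel₀ hne
    have h1 := H1_eq k
    have h2 := E1_eq k
    have h3 := D_eq k
    linear_combination H1 * h3 + tt k * H1 * h2 - Eser k Polynomial.X * h1
  have hθD : (1 - tt k) * theta D = Nser k Polynomial.X * Eser k Polynomial.X - tt k * (Nser k 1 * Eser k 1) := by
    have h := congrArg theta (D_eq k)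
    have ht : theta (tt k) = 0 := theta_C _
    have h1 : theta (1 : PowerSeries (Polynomial (MvPolynomial (Fin k) ℚ))) = 0 := by
      have := theta_C (1 : Polynomial (MvPolynomial (Fin k) ℚ))
      simpa using this
    rw [theta_mul, theta_sub, theta_sub, theta_mul, theta_Eser, theta_Eser, ht, h1] at h
    linear_combination h
  have hDH : D * theta H = - theta D + D * Nser k 1 := by
    apply mul_left_cancel₀ hne
    rw [hθH]
    have h3 := D_eq k
    have h4 := qq_N k
    linear_combination (1 - tt k) * PowerSeries.mk (qq k) * hDH1 + hθD - Nser k 1 * h3 - Eser k Polynomial.X * h4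
  have hdt := congrArg dt hDH
  have hneg : ∀ f : PowerSeries (Polynomial (MvPolynomial (Fin k) ℚ)), dt (-f) = - dt f := by
    intro f; ext1 n; simp [dt]
  rw [dt_mul, dt_add, hneg, dt_mul, dt_N1, dt_theta, dt_theta] at hdt
  have hK : dt D + D * dt H = 0 := by
    refine theta_ode _ (Nser k 1 - theta H) ?_ ?_ ?_
    · rw [map_sub, coeff_zero_N]; simp [theta]
    · have e1 : PowerSeries.coeff 0 (dt D) = 0 := by simp [dt, hD, Dser]
      have e2 : PowerSeries.coeff 0 (dt H) = 0 := by
        rw [dt, PowerSeries.coeff_mk, hH, coeff_zero_Phi]; simp [alpha']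
      rw [map_add, PowerSeries.coeff_mul, e1]
      simp only [Finset.Nat.antidiagonal_zero, Finset.sum_singleton, e2]; simp
    · rw [theta_add, theta_mul]
      linear_combination hdt + dt H * hDH
  linear_combination hK

theorem coeff_dt_H (n : ℕ) (hn : 1 ≤ n) : PowerSeries.coeff n (dt (Phi (qq k) (alpha' k))) =
    ∑ μ : n.Partition, ((-1 : ℚ) ^ (n - μ.parts.card) / (zlam μ : ℚ)) •
        (cless k n μ * Polynomial.C (psumPart (Fin k) ℚ μ)) := by
  simp only [dt, Phi, PowerSeries.coeff_mk]
  rw [Polynomial.derivative_sum]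
  refine Finset.sum_congr rfl fun μ _ => ?_
  have hcard : μ.parts.card ≠ 0 := by
    intro h0
    rw [Multiset.card_eq_zero] at h0
    have := μ.parts_sum
    rw [h0] at this
    simp at this; omega
  have hle : μ.parts.card ≤ n := by
    have h := Multiset.card_nsmul_le_sum (s := μ.parts) (a := 1) (fun x hx => μ.parts_pos hx)
    rw [μ.parts_sum] at h; simpa using h
  have hc : cless k n μ = Polynomial.derivative (alpha' k μ.parts.card * (μ.parts.map (tnum ℚ k)).prod) := by
    unfold cless alpha' alpha
    rw [if_neg hcard]
    by_cases h1 : μ.parts.card = 1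
    · rw [if_pos h1, h1]
      obtain ⟨a, ha⟩ := Multiset.card_eq_one.1 h1
      have := μ.parts_sum
      rw [ha] at this ⊢
      simp at this
      simp [this]
    · rw [if_neg h1, if_neg (by omega)]
  have hprod : (μ.parts.map (qq k)).prod = Polynomial.C (MvPolynomial.C ((-1 : ℚ) ^ (n - μ.parts.card))) * (μ.parts.map (tnum ℚ k)).prod * Polynomial.C (psumPart (Fin k) ℚ μ) := by
    have e : ∀ s : Multiset ℕ, (s.map (qq k)).prod = (-1) ^ (s.sum + s.card) * (s.map (tnum ℚ k)).prod * Polynomial.C ((s.map (psum (Fin k) ℚ)).prod) := by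
      intro s
      induction s using Multiset.induction_on with
      | empty => simp
      | cons a s ih =>
        simp only [Multiset.map_cons, Multiset.prod_cons, ih, Multiset.sum_cons, Multiset.card_cons, qq, map_mul]
        ring
    rw [e, μ.parts_sum, psumPart]
    congr 2
    obtain ⟨d, hd⟩ := Nat.exists_eq_add_of_le hle
    rw [show n + μ.parts.card = d + 2 * μ.parts.card by omega, show n - μ.parts.card = d by omega, neg_one_pow_add_two]
    simp only [map_pow, map_neg, map_one]
  have hz : zl μ.parts = zlam μ := rfl
  rw [wtm, hprod, hc, hz]
  have h1 : ∀ f g : Polynomial (MvPolynomial (Fin k) ℚ), ∀ p : MvPolynomial (Fin k) ℚ, ∀ r z : ℚ, 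
      Polynomial.derivative (f * ((1 / z) • (Polynomial.C (MvPolynomial.C r) * g * Polynomial.C p))) =
        (r / z) • (Polynomial.derivative (f * g) * Polynomial.C p) := by
    intro f g p r z
    have e1 : ∀ (c : ℚ) (h : Polynomial (MvPolynomial (Fin k) ℚ)), c • h = Polynomial.C (MvPolynomial.C c) * h := by
      intro c h
      rw [Algebra.smul_def]; rfl
    rw [e1, e1]
    have e2 : (r / z) = r * (1 / z) := by ring
    have e3 : f * (Polynomial.C (MvPolynomial.C (1 / z)) * (Polynomial.C (MvPolynomial.C r) * g * Polynomial.C p))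
        = Polynomial.C (MvPolynomial.C (r / z) * p) * (f * g) := by
      rw [e2]
      simp only [map_mul]
      ring
    rw [e3, Polynomial.derivative_C_mul, map_mul]
    ring
  exact h1 _ _ _ _ _

end final

/-- `W_n^<(x,t) = Σ_{λ ⊢ n} (-1)^{n-ℓ(λ)} c_λ^<(t) p_λ(x)/z_λ`. -/
theorem smirnov_lt_power_sum_expansion (n k : ℕ) (hn : 1 ≤ n) (hk : 1 ≤ k) :
    smirnovEnum ℚ n k desc FirstLtLast =
      ∑ μ : n.Partition, ((-1 : ℚ) ^ (n - μ.parts.card) / (zlam μ : ℚ)) •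
        (cless k n μ * Polynomial.C (psumPart (Fin k) ℚ μ)) := by
  rw [← coeff_dt_H k n hn]
  obtain ⟨m, rfl⟩ := Nat.exists_eq_add_of_le' hn
  rw [← coeff_Wser]
  congr 1
  have hD : Dser ℚ k ≠ 0 := by
    intro h
    have := congrArg (PowerSeries.coeff 0) h
    simp [Dser] at this
  apply mul_left_cancel₀ hD
  rw [H_eq, mul_comm, Wser_eq]

end
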